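/- arXiv:1404.3911 — 2 statements merged into one kernel-verified Lean document; each statement's English description precedes it below -/
import Mathlib

section
/- Let k be an algebraically closed field and let r ≥ 2 and d₁ ≥ d₂ ≥ ⋯ ≥ d_r ≥ 1 be integers, d = d₁+⋯+d_r, D = Σ_{1≤i<j≤r} d_i d_j. Then there exist nonzero homogeneous polynomials F₁,…,F_r ∈ k[x₀,x₁,x₂] with deg F_i = d_i such that for every integer j ≥ d−2 the Hilbert function of R/I_F satisfies H(R/I_F, j) = D, i.e. C(j+2,2) − dim_k (I_F)_j = D. (Proposition 2.1(i): for a general point [F] = [F₁⋯F_r] of X_{2,λ}, the scheme defined by I_F is a set of D points imposing independent conditions in all degrees ≥ d−2.) -/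
open MvPolynomial Finset

/-- The ideal `I_F = ⋂_{i<j} (F_i, F_j)` associated to a tuple of forms. -/
noncomputable def idealOfForms {k : Type*} [Field k] {r : ℕ}
    (F : Fin r → MvPolynomial (Fin 3) k) : Ideal (MvPolynomial (Fin 3) k) :=
  ⨅ (i : Fin r) (j : Fin r) (_ : i < j), Ideal.span {F i, F j}

/-- `dim_k (I)_n`, the dimension of the degree-`n` homogeneous part of the ideal `I`. -/
noncomputable def gradedDim {k : Type*} [Field k]
    (I : Ideal (MvPolynomial (Fin 3) k)) (n : ℕ) : ℕ :=
  Module.finrank k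
    ↥(Submodule.restrictScalars k I ⊓ homogeneousSubmodule (Fin 3) k n)

/-- `D = Σ_{1 ≤ i < j ≤ r} d_i d_j`. -/
def Dval {r : ℕ} (d : Fin r → ℕ) : ℕ :=
  ∑ q ∈ univ.filter (fun q : Fin r × Fin r => q.1 < q.2), d q.1 * d q.2

/-- `s = d_2 + ⋯ + d_r`. -/
def sval {r : ℕ} (d : Fin r → ℕ) : ℕ :=
  ∑ i ∈ univ.filter (fun i : Fin r => i.val ≠ 0), d i

/-- `p = Σ_{2 ≤ i < j ≤ r} d_i d_j = D - d_1 s`. -/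
def pval {r : ℕ} (d : Fin r → ℕ) : ℕ :=
  ∑ q ∈ univ.filter (fun q : Fin r × Fin r => q.1 < q.2 ∧ q.1.val ≠ 0), d q.1 * d q.2

/-! ### Ideals generated by pairs of elements -/

/-- If `G` is a non-zero-divisor modulo `(a, h)` and `(b, h)`, and `h` is prime to `a`, then `G`
is a non-zero-divisor modulo `(a * b, h)`. -/
lemma mem_span_mul_pair_of_mul_mem {R : Type*} [CommRing R] [DecompositionMonoid R]
    {a b h G : R} (hah : IsRelPrime h a)
    (ha : ∀ x, G * x ∈ Ideal.span {a, h} → x ∈ Ideal.span {a, h})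
    (hb : ∀ x, G * x ∈ Ideal.span {b, h} → x ∈ Ideal.span {b, h})
    (x : R) (hx : G * x ∈ Ideal.span {a * b, h}) : x ∈ Ideal.span {a * b, h} := by
  obtain ⟨u, v, huv⟩ := Ideal.mem_span_pair.1 hx
  obtain ⟨w, t, hwt⟩ := Ideal.mem_span_pair.1
    (ha x (Ideal.mem_span_pair.2 ⟨u * b, v, by rw [← huv]; ring⟩))
  obtain ⟨c, hc⟩ : h ∣ G * w - b * u :=
    hah.dvd_of_dvd_mul_left (z := G * w - b * u)
      ⟨v - G * t, by linear_combination -huv + G * hwt⟩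
  obtain ⟨p, q, hpq⟩ := Ideal.mem_span_pair.1
    (hb w (Ideal.mem_span_pair.2 ⟨u, c, by linear_combination -hc⟩))
  exact Ideal.mem_span_pair.2 ⟨p, q * a + t, by linear_combination hwt + a * hpq⟩

/-- If `G` is a non-zero-divisor modulo `(a, h)` then it is so modulo `(a ^ n, h)`, provided that
`a` and `h` are relatively prime. -/
lemma mem_span_pow_pair_of_mul_mem {R : Type*} [CommRing R] [DecompositionMonoid R]
    {a h G : R} (hah : IsRelPrime h a)
    (ha : ∀ x, G * x ∈ Ideal.span {a, h} → x ∈ Ideal.span {a, h}) (n : ℕ) :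
    ∀ x, G * x ∈ Ideal.span {a ^ n, h} → x ∈ Ideal.span {a ^ n, h} := by
  induction n with
  | zero =>
    intro x _
    exact Ideal.mem_span_pair.2 ⟨x, 0, by ring⟩
  | succ n ih =>
    rw [pow_succ']
    exact mem_span_mul_pair_of_mul_mem hah ha ih

lemma mem_of_pow_mul_mem {R : Type*} [CommRing R] {I : Ideal R} {G : R}
    (hG : ∀ x, G * x ∈ I → x ∈ I) (n : ℕ) : ∀ x, G ^ n * x ∈ I → x ∈ I := by
  induction n with
  | zero => intro x hx; simpa using hx
  | succ n ih =>
    intro x hx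
    rw [pow_succ, mul_assoc] at hx
    exact hG x (ih _ hx)

lemma mem_of_prod_mul_mem {R ι : Type*} [CommRing R] {I : Ideal R} {G : ι → R} {s : Finset ι}
    (hG : ∀ i ∈ s, ∀ x, G i * x ∈ I → x ∈ I) : ∀ x, (∏ i ∈ s, G i) * x ∈ I → x ∈ I := by
  classical
  induction s using Finset.induction_on with
  | empty => intro x hx; simpa using hx
  | insert a s has ih =>
    intro x hx
    rw [prod_insert has, mul_assoc] at hx
    exact ih (fun i hi => hG i (mem_insert_of_mem hi)) x (hG a (mem_insert_self a s) _ hx)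

/-- If the `F i` are pairwise regular modulo `G`, then `⋂ i, (F i, G) ⊆ (∏ i, F i, G)`. -/
lemma mem_span_prod_pair {R ι : Type*} [CommRing R] {F : ι → R} {G : R} {s : Finset ι}
    (h : ∀ i ∈ s, ∀ j ∈ s, i ≠ j → ∀ x, F i * x ∈ Ideal.span {F j, G} → x ∈ Ideal.span {F j, G})
    {f : R} (hf : ∀ i ∈ s, f ∈ Ideal.span {F i, G}) : f ∈ Ideal.span {∏ i ∈ s, F i, G} := by
  classical
  induction s using Finset.induction_on with
  | empty => exact Ideal.mem_span_pair.2 ⟨f, 0, by simp⟩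
  | insert a s has ih =>
    obtain ⟨u, v, huv⟩ := Ideal.mem_span_pair.1 (ih
      (fun i hi j hj => h i (mem_insert_of_mem hi) j (mem_insert_of_mem hj))
      (fun i hi => hf i (mem_insert_of_mem hi)))
    have hu : u ∈ Ideal.span {F a, G} := by
      refine mem_of_prod_mul_mem (s := s) (G := F) (fun i hi => h i (mem_insert_of_mem hi) a
        (mem_insert_self a s) (fun e => has (e ▸ hi))) u ?_
      obtain ⟨p, q, hpq⟩ := Ideal.mem_span_pair.1 (hf a (mem_insert_self a s))
      exact Ideal.mem_span_pair.2 ⟨p, q - v, by linear_combination hpq - huv⟩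
    obtain ⟨p, q, hpq⟩ := Ideal.mem_span_pair.1 hu
    rw [prod_insert has]
    exact Ideal.mem_span_pair.2
      ⟨p, q * (∏ i ∈ s, F i) + v, by linear_combination huv + (∏ i ∈ s, F i) * hpq⟩

/-! ### Dimensions of graded pieces -/

section GradedPieces

variable {k : Type*} [Field k]

lemma homogeneousComponent_mul_of_isHomogeneous {σ : Type*} {b : MvPolynomial σ k} {m : ℕ}
    (hb : b.IsHomogeneous m) (a : MvPolynomial σ k) (n : ℕ) :
    homogeneousComponent n (a * b) =
      if m ≤ n then homogeneousComponent (n - m) a * b else 0 := by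
  let := MvPolynomial.gradedAlgebra (σ := σ) (R := k)
  have hdec (φ : MvPolynomial σ k) (i : ℕ) :
      (DirectSum.decompose (homogeneousSubmodule σ k) φ i : MvPolynomial σ k) =
        homogeneousComponent i φ := decomposition.decompose'_apply φ i
  rw [← hdec, ← hdec]
  exact DirectSum.coe_decompose_mul_of_right_mem (homogeneousSubmodule σ k) n
    ((mem_homogeneousSubmodule m b).2 hb)

/-- A homogeneous component of a multiple of a form `b` is again a multiple of `b`. -/
lemma exists_homogeneousComponent_mul {σ : Type*} {b : MvPolynomial σ k} {m : ℕ}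
    (hb : b.IsHomogeneous m) (a : MvPolynomial σ k) (n : ℕ) :
    ∃ c, homogeneousComponent n (a * b) = c * b := by
  rw [homogeneousComponent_mul_of_isHomogeneous hb]
  split_ifs
  · exact ⟨_, rfl⟩
  · exact ⟨0, (zero_mul b).symm⟩

lemma isHomogeneous_of_mul {σ : Type*} {F z : MvPolynomial σ k} {e n : ℕ}
    (hF : F.IsHomogeneous e) (hF0 : F ≠ 0) (hz : (F * z).IsHomogeneous (n + e)) :
    z.IsHomogeneous n := by
  have h := homogeneousComponent_mul_of_isHomogeneous hF z (n + e)
  rw [mul_comm, homogeneousComponent_of_mem hz, if_pos rfl, if_pos (Nat.le_add_left _ _),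
    Nat.add_sub_cancel, mul_comm F] at h
  rw [mul_right_cancel₀ hF0 h]
  exact homogeneousComponent_isHomogeneous n z

lemma eq_zero_of_isHomogeneous_mul {σ : Type*} {F z : MvPolynomial σ k} {e n : ℕ}
    (hF : F.IsHomogeneous e) (hz : (F * z).IsHomogeneous n) (hn : n < e) : F * z = 0 := by
  have h := homogeneousComponent_mul_of_isHomogeneous hF z n
  rwa [mul_comm, homogeneousComponent_of_mem hz, if_pos rfl, if_neg (by omega)] at h

instance finiteDimensional_homogeneousSubmodule {σ : Type*} [Finite σ] (n : ℕ) :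
    FiniteDimensional k (homogeneousSubmodule σ k n) :=
  Module.Finite.iff_fg.2 (homogeneousSubmodule_fg σ k n)

lemma gradedDim_top (n : ℕ) :
    gradedDim (⊤ : Ideal (MvPolynomial (Fin 3) k)) n = (n + 2).choose 2 := by
  have h : (Submodule.restrictScalars k (⊤ : Ideal (MvPolynomial (Fin 3) k)) ⊓
      homogeneousSubmodule (Fin 3) k n) = restrictSupport k {d | d.degree = n} := by
    rw [Submodule.restrictScalars_top, top_inf_eq, homogeneousSubmodule_eq_finsupp_supported]
    rfl
  have hs : {d : Fin 3 →₀ ℕ | d.degree = n} = ↑(finsuppAntidiag (univ : Finset (Fin 3)) n) := by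
    ext d
    simp [Finsupp.degree_eq_sum]
  rw [gradedDim, h, Module.finrank_eq_nat_card_basis (basisRestrictSupport k _), hs]
  simp only [Finset.coe_sort_coe, Nat.card_eq_fintype_card, Fintype.card_coe]
  rw [card_finsuppAntidiag_nat_eq_choose]
  simp only [card_univ, Fintype.card_fin]
  rw [show 3 + n - 1 = n + 2 by omega, ← Nat.choose_symm_add]

/-- `dim_k (I)_{N-2}`, which is zero for `N < 2`. -/
noncomputable def shiftedDim (I : Ideal (MvPolynomial (Fin 3) k)) (N : ℕ) : ℕ :=
  if 2 ≤ N then gradedDim I (N - 2) else 0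

lemma shiftedDim_top (N : ℕ) :
    shiftedDim (⊤ : Ideal (MvPolynomial (Fin 3) k)) N = N.choose 2 := by
  unfold shiftedDim
  split_ifs with h
  · rw [gradedDim_top, Nat.sub_add_cancel h]
  · exact (Nat.choose_eq_zero_of_lt (by omega)).symm

lemma gradedDim_span_singleton_mul {F : MvPolynomial (Fin 3) k} {e : ℕ}
    (hF : F.IsHomogeneous e) (hF0 : F ≠ 0) (J : Ideal (MvPolynomial (Fin 3) k)) (n : ℕ) :
    gradedDim (Ideal.span {F} * J) (n + e) = gradedDim J n := by
  have hinj : Function.Injective (LinearMap.mulLeft k F) := fun x y h => mul_left_cancel₀ hF0 h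
  have hmap : (Submodule.restrictScalars k (Ideal.span {F} * J) ⊓
      homogeneousSubmodule (Fin 3) k (n + e)) = Submodule.map (LinearMap.mulLeft k F)
        (Submodule.restrictScalars k J ⊓ homogeneousSubmodule (Fin 3) k n) := by
    apply le_antisymm
    · rintro x ⟨hx, hxn⟩
      obtain ⟨z, hz, rfl⟩ := Ideal.mem_span_singleton_mul.1 hx
      exact ⟨z, ⟨hz, isHomogeneous_of_mul hF hF0 hxn⟩, rfl⟩
    · rintro _ ⟨z, ⟨hz, hzn⟩, rfl⟩
      refine ⟨Ideal.mem_span_singleton_mul.2 ⟨z, hz, rfl⟩, ?_⟩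
      rw [add_comm]
      exact hF.mul hzn
  rw [gradedDim, gradedDim, hmap]
  exact (Submodule.equivMapOfInjective _ hinj _).finrank_eq.symm

lemma gradedDim_span_singleton_mul_of_lt {F : MvPolynomial (Fin 3) k} {e n : ℕ}
    (hF : F.IsHomogeneous e) (J : Ideal (MvPolynomial (Fin 3) k)) (hn : n < e) :
    gradedDim (Ideal.span {F} * J) n = 0 := by
  have : (Submodule.restrictScalars k (Ideal.span {F} * J) ⊓
      homogeneousSubmodule (Fin 3) k n) = ⊥ := by
    rw [eq_bot_iff]
    rintro x ⟨hx, hxn⟩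
    obtain ⟨z, _, rfl⟩ := Ideal.mem_span_singleton_mul.1 hx
    exact eq_zero_of_isHomogeneous_mul hF hxn hn
  rw [gradedDim, this, finrank_bot]

lemma shiftedDim_span_singleton_mul {F : MvPolynomial (Fin 3) k} {e N : ℕ}
    (hF : F.IsHomogeneous e) (hF0 : F ≠ 0) (J : Ideal (MvPolynomial (Fin 3) k)) (hN : e ≤ N) :
    shiftedDim (Ideal.span {F} * J) N = shiftedDim J (N - e) := by
  unfold shiftedDim
  by_cases h : 2 ≤ N - e
  · rw [if_pos h, if_pos (by omega), ← gradedDim_span_singleton_mul hF hF0 J (N - e - 2),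
      show N - e - 2 + e = N - 2 by omega]
  · rw [if_neg h]
    split_ifs
    · exact gradedDim_span_singleton_mul_of_lt hF J (by omega)
    · rfl

/-- The Hilbert function of `F J + (P)`, when `P ∈ J` is prime to the form `F` and `F` is a
non-zero-divisor modulo `J`. -/
lemma gradedDim_sup_add_gradedDim {F P : MvPolynomial (Fin 3) k} {e m : ℕ}
    {J : Ideal (MvPolynomial (Fin 3) k)} (hF : F.IsHomogeneous e) (hP : P.IsHomogeneous m) (hPJ : P ∈ J)
    (hreg : ∀ x, F * x ∈ J → x ∈ J) (hFP : IsRelPrime F P) (n : ℕ) :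
    gradedDim (Ideal.span {F} * J ⊔ Ideal.span {P}) n + gradedDim (Ideal.span {F * P}) n =
      gradedDim (Ideal.span {F} * J) n + gradedDim (Ideal.span {P}) n := by
  let V (I : Ideal (MvPolynomial (Fin 3) k)) : Submodule k (MvPolynomial (Fin 3) k) :=
    Submodule.restrictScalars k I ⊓ homogeneousSubmodule (Fin 3) k n
  have hfin (I) : FiniteDimensional k (V I) := Submodule.finiteDimensional_inf_right _ _
  have hsup : V (Ideal.span {F} * J ⊔ Ideal.span {P}) =
      V (Ideal.span {F} * J) ⊔ V (Ideal.span {P}) := by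
    apply le_antisymm
    · rintro f ⟨hf, hfn⟩
      obtain ⟨_, hy, _, hz, rfl⟩ := Submodule.mem_sup.1 hf
      obtain ⟨a, ha, rfl⟩ := Ideal.mem_span_singleton_mul.1 hy
      obtain ⟨b, rfl⟩ := Ideal.mem_span_singleton'.1 hz
      obtain ⟨a', ha'⟩ := exists_homogeneousComponent_mul hF a n
      obtain ⟨b', hb'⟩ := exists_homogeneousComponent_mul hP b n
      have hcomp : a' * F + b' * P = F * a + b * P := by
        rw [← ha', ← hb', ← map_add, mul_comm a]
        exact (homogeneousComponent_of_mem hfn).trans (if_pos rfl)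
      have ha'J : a' ∈ J := by
        refine hreg a' ?_
        rw [show F * a' = F * a + (b - b') * P by linear_combination hcomp]
        exact J.add_mem (J.mul_mem_left _ ha) (J.mul_mem_left _ hPJ)
      rw [← hcomp]
      refine Submodule.add_mem_sup ⟨?_, ?_⟩ ⟨?_, ?_⟩
      · exact Ideal.mem_span_singleton_mul.2 ⟨a', ha'J, mul_comm _ _⟩
      · rw [← ha']
        exact homogeneousComponent_isHomogeneous n _
      · exact Ideal.mem_span_singleton'.2 ⟨b', rfl⟩
      · rw [← hb']
        exact homogeneousComponent_isHomogeneous n _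
    · refine sup_le ?_ ?_
      · exact inf_le_inf_right _ (fun x hx => Ideal.mem_sup_left hx)
      · exact inf_le_inf_right _ (fun x hx => Ideal.mem_sup_right hx)
  have hinf : V (Ideal.span {F * P}) = V (Ideal.span {F} * J) ⊓ V (Ideal.span {P}) := by
    apply le_antisymm
    · rintro f ⟨hf, hfn⟩
      obtain ⟨c, rfl⟩ := Ideal.mem_span_singleton.1 hf
      exact ⟨⟨Ideal.mem_span_singleton_mul.2 ⟨P * c, J.mul_mem_right _ hPJ, by ring⟩, hfn⟩,
        Ideal.mem_span_singleton.2 ⟨F * c, by ring⟩, hfn⟩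
    · rintro f ⟨⟨hf, hfn⟩, hf', -⟩
      obtain ⟨a, -, rfl⟩ := Ideal.mem_span_singleton_mul.1 hf
      obtain ⟨c, hc⟩ := Ideal.mem_span_singleton.1 hf'
      obtain ⟨u, rfl⟩ := hFP.dvd_of_dvd_mul_left (z := c) ⟨a, hc.symm⟩
      exact ⟨Ideal.mem_span_singleton.2 ⟨u, by rw [hc]; ring⟩, hfn⟩
  have := Submodule.finrank_sup_add_finrank_inf_eq (V (Ideal.span {F} * J)) (V (Ideal.span {P}))
  rwa [← hsup, ← hinf] at this

/-- The sets of points defined by a family of forms no three of which vanish simultaneously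
impose independent conditions in all degrees at least `∑ i, d i - 2`. -/
lemma shiftedDim_idealOfForms_add_Dval {n : ℕ} {F : Fin n → MvPolynomial (Fin 3) k}
    {d : Fin n → ℕ} (h0 : ∀ i, F i ≠ 0) (hF : ∀ i, (F i).IsHomogeneous (d i))
    (hrel : ∀ i j, i ≠ j → IsRelPrime (F i) (F j))
    (hreg : ∀ i j l, i ≠ j → i ≠ l → j ≠ l →
      ∀ x, F l * x ∈ Ideal.span {F i, F j} → x ∈ Ideal.span {F i, F j})
    (N : ℕ) (hN : ∑ i, d i ≤ N) :
    shiftedDim (idealOfForms F) N + Dval d = N.choose 2 := by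
  induction n generalizing N with
  | zero =>
    have : idealOfForms F = ⊤ := iInf_of_empty _
    simp [this, shiftedDim_top, Dval]
  | succ n ih =>
    rw [Fin.sum_univ_castSucc] at hN
    set G : MvPolynomial (Fin 3) k := F (Fin.last n) with hG
    set e := d (Fin.last n)
    set m := ∑ i : Fin n, d i.castSucc
    set P := ∏ i : Fin n, F i.castSucc
    set J := idealOfForms fun i : Fin n => F i.castSucc
    have hne (i : Fin n) : i.castSucc ≠ Fin.last n := (Fin.castSucc_lt_last i).ne
    have hJ := fun N hN => ih (F := fun i => F i.castSucc) (d := fun i => d i.castSucc)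
      (fun i => h0 _) (fun i => hF _) (fun i j hij => hrel _ _ (by simpa using hij))
      (fun i j l hij hil hjl => hreg _ _ _ (by simpa using hij) (by simpa using hil)
        (by simpa using hjl)) N hN
    have hP : P.IsHomogeneous m := IsHomogeneous.prod _ _ _ fun i _ => hF _
    have hP0 : P ≠ 0 := prod_ne_zero_iff.2 fun i _ => h0 _
    have hmemJ (x) : x ∈ J ↔ ∀ i j : Fin n, i < j →
        x ∈ Ideal.span {F i.castSucc, F j.castSucc} := by
      simp [J, idealOfForms]
    have hPJ : P ∈ J := (hmemJ P).2 fun i j _ =>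
      Ideal.mem_of_dvd _ (dvd_prod_of_mem _ (mem_univ i)) (Ideal.subset_span (by simp))
    have hregJ : ∀ x, G * x ∈ J → x ∈ J := fun x hx => (hmemJ x).2 fun i j hij =>
      hreg _ _ _ (by simpa using hij.ne) (hne i) (hne j) x ((hmemJ _).1 hx i j hij)
    have hGP : IsRelPrime G P := IsRelPrime.prod_right fun i _ => hrel _ _ (hne i).symm
    have hI : idealOfForms F = Ideal.span {G} * J ⊔ Ideal.span {P} := by
      have hmem (x) : x ∈ idealOfForms F ↔
          x ∈ J ∧ ∀ i : Fin n, x ∈ Ideal.span {F i.castSucc, G} := by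
        rw [hmemJ]
        simp [idealOfForms, Fin.forall_fin_succ', forall_and, hG,
          Fin.castSucc_lt_last, (Fin.castSucc_lt_last _).not_gt]
      ext f
      rw [hmem]
      constructor
      · rintro ⟨hfJ, hf⟩
        obtain ⟨b, a, hab⟩ := Ideal.mem_span_pair.1 (mem_span_prod_pair (s := univ)
          (F := fun i : Fin n => F i.castSucc) (G := G)
          (fun i _ j _ hij => hreg _ _ _ (hne j) (by simpa using hij.symm) (hne i).symm)
          (fun i _ => hf i))
        have ha : a ∈ J := hregJ a (by
          rw [show G * a = f - b * P by rw [← hab]; ring]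
          exact J.sub_mem hfJ (J.mul_mem_left _ hPJ))
        rw [← hab, add_comm]
        exact Submodule.add_mem_sup (Ideal.mem_span_singleton_mul.2 ⟨a, ha, mul_comm _ _⟩)
          (Ideal.mem_span_singleton'.2 ⟨b, rfl⟩)
      · intro hf
        obtain ⟨_, hy, _, hz, rfl⟩ := Submodule.mem_sup.1 hf
        obtain ⟨a, ha, rfl⟩ := Ideal.mem_span_singleton_mul.1 hy
        obtain ⟨b, rfl⟩ := Ideal.mem_span_singleton'.1 hz
        refine ⟨J.add_mem (J.mul_mem_left _ ha) (J.mul_mem_left _ hPJ), fun i => ?_⟩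
        obtain ⟨c, hc⟩ : F i.castSucc ∣ P := dvd_prod_of_mem _ (mem_univ i)
        exact Ideal.mem_span_pair.2 ⟨b * c, a, by rw [hc]; ring⟩
    have hdim : shiftedDim (idealOfForms F) N + (N - (e + m)).choose 2 =
        shiftedDim J (N - e) + (N - m).choose 2 := by
      rw [← shiftedDim_span_singleton_mul (hF _) (h0 _) J (by omega), ← shiftedDim_top (k := k),
        ← shiftedDim_top (k := k),
        ← shiftedDim_span_singleton_mul hP hP0 ⊤ (by omega),
        ← shiftedDim_span_singleton_mul ((hF _).mul hP) (mul_ne_zero (h0 _) hP0) ⊤ (by omega),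
        Ideal.mul_top, Ideal.mul_top, hI]
      unfold shiftedDim
      split_ifs
      · exact gradedDim_sup_add_gradedDim (hF _) hP hPJ hregJ hGP _
      · rfl
    have hD : Dval d = Dval (fun i : Fin n => d i.castSucc) + m * e := by
      simp [Dval, sum_filter, ← univ_product_univ, sum_product, Fin.sum_univ_castSucc,
        sum_add_distrib, sum_mul, Fin.castSucc_lt_last, (Fin.castSucc_lt_last _).not_gt, m, e]
    have hJN := hJ (N - e) (by omega)
    obtain ⟨t, rfl⟩ := Nat.exists_eq_add_of_le hN
    rw [show m + e + t - (e + m) = t by omega, show m + e + t - e = m + t by omega,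
      show m + e + t - m = e + t by omega] at hdim
    rw [show m + e + t - e = m + t by omega] at hJN
    have hc : (m + e + t).choose 2 + t.choose 2 =
        (m + t).choose 2 + (e + t).choose 2 + m * e := by
      have : ((m + e + t).choose 2 + t.choose 2 : ℚ) =
          (m + t).choose 2 + (e + t).choose 2 + m * e := by
        simp only [Nat.cast_choose_two]
        push_cast
        ring
      exact_mod_cast this
    change shiftedDim J (m + t) + _ = _ at hJN
    omega

end GradedPieces

/-! ### Linear forms in general position -/

section LinearForms

variable {k : Type*} [Field k]

/-- An element killed by an endomorphism of the polynomial ring belongs to every ideal modulo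
which this endomorphism is the identity. -/
lemma mem_of_aeval_eq_zero {σ : Type*} {I : Ideal (MvPolynomial σ k)}
    {v : σ → MvPolynomial σ k} (hv : ∀ i, X i - v i ∈ I) {f : MvPolynomial σ k}
    (hf : aeval v f = 0) : f ∈ I := by
  have h : (Ideal.Quotient.mkₐ k I).comp (aeval v) = Ideal.Quotient.mkₐ k I := by
    ext i
    simpa using (Ideal.Quotient.eq.2 (hv i)).symm
  have := DFunLike.congr_fun h f
  rw [AlgHom.comp_apply, hf, map_zero] at this
  exact Ideal.Quotient.eq_zero_iff_mem.1 this.symm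

/-- The linear form `x₀ + t x₁ + t² x₂`; no three of these vanish simultaneously. -/
noncomputable def conicForm (t : k) : MvPolynomial (Fin 3) k :=
  X 0 + C t * X 1 + C (t ^ 2) * X 2

lemma conicForm_isHomogeneous (t : k) : (conicForm t).IsHomogeneous 1 :=
  ((isHomogeneous_X k 0).add (isHomogeneous_C_mul_X t 1)).add (isHomogeneous_C_mul_X (t ^ 2) 2)

lemma aeval_conicForm (v : Fin 3 → MvPolynomial (Fin 3) k) (t : k) :
    aeval v (conicForm t) = v 0 + C t * v 1 + C (t ^ 2) * v 2 := by
  simp [conicForm, algebraMap_eq]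

lemma conicForm_ne_zero (t : k) : conicForm t ≠ 0 := by
  intro h
  have := congrArg (aeval ![1, 0, (0 : MvPolynomial (Fin 3) k)]) h
  rw [aeval_conicForm] at this
  simp at this

lemma mem_span_conicForm_of_mul_mem {s t u : k} (hst : s ≠ t) (hsu : s ≠ u) (htu : t ≠ u)
    (x : MvPolynomial (Fin 3) k) (hx : conicForm u * x ∈ Ideal.span {conicForm s, conicForm t}) :
    x ∈ Ideal.span {conicForm s, conicForm t} := by
  set v : Fin 3 → MvPolynomial (Fin 3) k := ![C (s * t) * X 2, -C (s + t) * X 2, X 2] with hv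
  have hval (a : k) : aeval v (conicForm a) = C ((a - s) * (a - t)) * X 2 := by
    rw [aeval_conicForm]
    simp [hv]
    ring
  refine mem_of_aeval_eq_zero (v := v) ?_ ?_
  · have hinv : (C (s - t)⁻¹ : MvPolynomial (Fin 3) k) * (C s - C t) = 1 := by
      rw [← C_sub, ← C_mul, inv_mul_cancel₀ (sub_ne_zero.2 hst), C_1]
    intro i
    refine Ideal.mem_span_pair.2 ?_
    fin_cases i
    · refine ⟨-C (s - t)⁻¹ * C t, C (s - t)⁻¹ * C s, ?_⟩
      simp [hv, conicForm]
      linear_combination (X 0 - C s * C t * X 2) * hinv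
    · refine ⟨C (s - t)⁻¹, -C (s - t)⁻¹, ?_⟩
      simp [hv, conicForm]
      linear_combination (X 1 + (C s + C t) * X 2) * hinv
    · exact ⟨0, 0, by simp [hv]⟩
  · obtain ⟨a, b, hab⟩ := Ideal.mem_span_pair.1 hx
    have h := congrArg (aeval v) hab
    rw [map_add, map_mul, map_mul, map_mul, hval, hval, hval] at h
    simp only [sub_self, zero_mul, mul_zero, C_0, add_zero] at h
    refine (mul_eq_zero.1 h.symm).resolve_left (mul_ne_zero ?_ (X_ne_zero 2))
    exact C_ne_zero.2 (mul_ne_zero (sub_ne_zero.2 hsu.symm) (sub_ne_zero.2 htu.symm))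

lemma conicForm_prime (t : k) : Prime (conicForm t) := by
  set v : Fin 3 → MvPolynomial (Fin 3) k := ![-C t * X 1 - C (t ^ 2) * X 2, X 1, X 2] with hv
  have h0 : aeval v (conicForm t) = 0 := by
    rw [aeval_conicForm]
    simp [hv]
    ring
  have hdvd (f : MvPolynomial (Fin 3) k) : conicForm t ∣ f ↔ aeval v f = 0 := by
    constructor
    · rintro ⟨g, rfl⟩
      rw [map_mul, h0, zero_mul]
    · intro hf
      refine Ideal.mem_span_singleton.1 (mem_of_aeval_eq_zero (v := v) (fun i => ?_) hf)
      refine Ideal.mem_span_singleton.2 ?_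
      fin_cases i
      · exact ⟨1, by simp [hv, conicForm]; ring⟩
      · simp [hv]
      · simp [hv]
  refine ⟨conicForm_ne_zero t, fun h => ?_, fun a b => ?_⟩
  · simpa using (hdvd 1).1 h.dvd
  · simp only [hdvd, map_mul, mul_eq_zero, imp_self]

lemma isRelPrime_conicForm {s t : k} (hst : s ≠ t) : IsRelPrime (conicForm s) (conicForm t) := by
  rw [(conicForm_prime s).irreducible.isRelPrime_iff_not_dvd]
  rintro ⟨c, hc⟩
  have := congrArg (aeval ![-C s, 1, (0 : MvPolynomial (Fin 3) k)]) hc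
  rw [map_mul, aeval_conicForm, aeval_conicForm] at this
  simp [neg_add_eq_zero] at this
  exact hst this

lemma mem_span_pow_conicForm_of_mul_mem {s t u : k} (hst : s ≠ t) (hsu : s ≠ u) (htu : t ≠ u)
    (a b c : ℕ) (x : MvPolynomial (Fin 3) k)
    (hx : conicForm u ^ c * x ∈ Ideal.span {conicForm s ^ a, conicForm t ^ b}) :
    x ∈ Ideal.span {conicForm s ^ a, conicForm t ^ b} := by
  refine mem_of_pow_mul_mem (fun y => ?_) c x hx
  refine mem_span_pow_pair_of_mul_mem (isRelPrime_conicForm hst).symm.pow_left ?_ a y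
  rw [Ideal.span_pair_comm]
  refine mem_span_pow_pair_of_mul_mem (isRelPrime_conicForm hst) ?_ b
  rw [Ideal.span_pair_comm]
  exact mem_span_conicForm_of_mul_mem hst hsu htu

end LinearForms

/-- Proposition 2.1(i): for a general point `[F] = [F₁⋯F_r]` of `X_{2,λ}`, the Hilbert
function of `R/I_F` equals `D` in every degree `j ≥ d - 2`. -/
theorem hilbert_function_eventually_D
    {k : Type*} [Field k] [IsAlgClosed k]
    (r : ℕ) [NeZero r] (hr : 2 ≤ r)
    (d : Fin r → ℕ)
    (hanti : ∀ i j : Fin r, i ≤ j → d j ≤ d i)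
    (hpos : ∀ i, 1 ≤ d i) :
    ∃ F : Fin r → MvPolynomial (Fin 3) k,
      (∀ i, F i ≠ 0 ∧ (F i).IsHomogeneous (d i)) ∧
      ∀ j : ℕ, (∑ i, d i) ≤ j + 2 →
        ((j + 2).choose 2 : ℤ) - gradedDim (idealOfForms F) j = Dval d := by
  let a : Fin r → k := fun i => Infinite.natEmbedding k i
  have ha {i j : Fin r} (hij : i ≠ j) : a i ≠ a j := fun h =>
    hij (Fin.ext ((Infinite.natEmbedding k).injective h))
  refine ⟨fun i => conicForm (a i) ^ d i, fun i => ⟨pow_ne_zero _ (conicForm_ne_zero _), ?_⟩,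
    fun j hj => ?_⟩
  · simpa using (conicForm_isHomogeneous (a i)).pow (d i)
  · have h := shiftedDim_idealOfForms_add_Dval (F := fun i => conicForm (a i) ^ d i) (d := d)
      (fun i => pow_ne_zero _ (conicForm_ne_zero _))
      (fun i => by simpa using (conicForm_isHomogeneous (a i)).pow (d i))
      (fun i j hij => (isRelPrime_conicForm (ha hij)).pow)
      (fun i j l hij hil hjl =>
        mem_span_pow_conicForm_of_mul_mem (ha hij) (ha hil) (ha hjl) _ _ _) (j + 2) hj
    rw [shiftedDim, if_pos (Nat.le_add_left _ _), Nat.add_sub_cancel] at h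
    rw [← h]
    push_cast
    ring
end

section
/- Let k be an algebraically closed field and let r ≥ 2 and d₁ ≥ d₂ ≥ ⋯ ≥ d_r ≥ 1 be integers, d = d₁+⋯+d_r. Then there exist nonzero homogeneous polynomials F₁,…,F_r ∈ k[x₀,x₁,x₂] with deg F_i = d_i such that for every integer j with 0 ≤ j ≤ d−1 the Hilbert function of R/I_F satisfies H(R/I_F, j) = C(j+2,2) − Σ_{i=1}^r C(max{j−d+d_i, −1} + 2, 2); equivalently dim_k (I_F)_j = Σ_{i=1}^r C(max{j−d+d_i, −1} + 2, 2). (Proposition 2.1(ii): the Hilbert function of the star-configuration-type scheme defined by a general λ-reducible form.) -/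
open MvPolynomial Finset

/-- `a` is a nonzerodivisor modulo the ideal `J`. -/
def IsNonzerodivisorMod {A : Type*} [CommRing A] (J : Ideal A) (a : A) : Prop :=
  ∀ x, a * x ∈ J → x ∈ J

namespace IsNonzerodivisorMod

variable {A ι : Type*} [CommRing A]

lemma prod {J : Ideal A} {a : ι → A} (s : Finset ι)
    (h : ∀ i ∈ s, IsNonzerodivisorMod J (a i)) : IsNonzerodivisorMod J (∏ i ∈ s, a i) := by
  classical
  induction s using Finset.induction_on with
  | empty => intro x hx; simpa using hx
  | insert i s hi ih =>
    intro x hx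
    rw [prod_insert hi, mul_assoc] at hx
    exact ih (fun l hl => h l (mem_insert_of_mem hl)) x (h i (mem_insert_self _ _) _ hx)

lemma span_singleton_prod [IsDomain A] {a : A} {c : ι → A} (s : Finset ι)
    (hc : ∀ i ∈ s, c i ≠ 0) (h : ∀ i ∈ s, IsNonzerodivisorMod (Ideal.span {c i}) a) :
    IsNonzerodivisorMod (Ideal.span {∏ i ∈ s, c i}) a := by
  classical
  induction s using Finset.induction_on with
  | empty => intro x _; simp
  | insert i s hi ih =>
    intro x hx
    rw [prod_insert hi, Ideal.mem_span_singleton] at hx ⊢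
    obtain ⟨y, rfl⟩ := Ideal.mem_span_singleton.1
      (h i (mem_insert_self _ _) x (Ideal.mem_span_singleton.2 (dvd_of_mul_right_dvd hx)))
    rw [mul_left_comm, mul_dvd_mul_iff_left (hc i (mem_insert_self _ _))] at hx
    exact mul_dvd_mul_left _ (Ideal.mem_span_singleton.1
      (ih (fun l hl => hc l (mem_insert_of_mem hl)) (fun l hl => h l (mem_insert_of_mem hl)) y
        (Ideal.mem_span_singleton.2 hx)))

lemma span_pair_mul {a b b' c : A} (hb : IsNonzerodivisorMod (Ideal.span {c}) b)
    (h : IsNonzerodivisorMod (Ideal.span {b, c}) a)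
    (h' : IsNonzerodivisorMod (Ideal.span {b', c}) a) :
    IsNonzerodivisorMod (Ideal.span {b * b', c}) a := by
  intro x hx
  obtain ⟨u, v, huv⟩ := Ideal.mem_span_pair.1 hx
  obtain ⟨y, z, rfl⟩ := Ideal.mem_span_pair.1
    (h x (Ideal.mem_span_pair.2 ⟨u * b', v, by rw [← huv]; ring⟩))
  have h1 : a * y - u * b' ∈ Ideal.span {c} :=
    hb _ (Ideal.mem_span_singleton'.2 ⟨v - a * z, by linear_combination huv⟩)
  obtain ⟨w, hw⟩ := Ideal.mem_span_singleton'.1 h1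
  obtain ⟨p, q, rfl⟩ := Ideal.mem_span_pair.1
    (h' y (Ideal.mem_span_pair.2 ⟨u, w, by linear_combination hw⟩))
  exact Ideal.mem_span_pair.2 ⟨p, q * b + z, by ring⟩

lemma span_prod_pair {a c : A} {b : ι → A} (s : Finset ι)
    (hb : ∀ i ∈ s, IsNonzerodivisorMod (Ideal.span {c}) (b i))
    (h : ∀ i ∈ s, IsNonzerodivisorMod (Ideal.span {b i, c}) a) :
    IsNonzerodivisorMod (Ideal.span {∏ i ∈ s, b i, c}) a := by
  classical
  induction s using Finset.induction_on with
  | empty =>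
    intro x _
    exact Ideal.mem_span_pair.2 ⟨x, 0, by simp⟩
  | insert i s hi ih =>
    rw [prod_insert hi]
    exact span_pair_mul (hb i (mem_insert_self _ _)) (h i (mem_insert_self _ _))
      (ih (fun l hl => hb l (mem_insert_of_mem hl)) (fun l hl => h l (mem_insert_of_mem hl)))

lemma of_algHom {R B : Type*} [CommRing R] [Algebra R A] [CommRing B] [IsDomain B] [Algebra R B]
    {J : Ideal A} (φ : A →ₐ[R] B) (hJ : ∀ x, x ∈ J ↔ φ x = 0) {a : A} (ha : φ a ≠ 0) :
    IsNonzerodivisorMod J a := by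
  intro x hx
  rw [hJ, map_mul] at hx
  exact (hJ x).2 ((mul_eq_zero.1 hx).resolve_left ha)

end IsNonzerodivisorMod

section Generators

variable {A ι : Type*} [CommRing A] [DecidableEq ι]

lemma mem_span_prod_pair_s4 {F : ι → A} {c g : A} (s : Finset ι)
    (h : ∀ i ∈ s, ∀ j ∈ s, i ≠ j → IsNonzerodivisorMod (Ideal.span {F i, c}) (F j))
    (hg : ∀ i ∈ s, g ∈ Ideal.span {F i, c}) : g ∈ Ideal.span {∏ i ∈ s, F i, c} := by
  induction s using Finset.induction_on with
  | empty => exact Ideal.mem_span_pair.2 ⟨g, 0, by simp⟩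
  | insert b s hb ih =>
    obtain ⟨u, v, rfl⟩ := Ideal.mem_span_pair.1
      (ih (fun i hi j hj => h i (mem_insert_of_mem hi) j (mem_insert_of_mem hj))
        (fun i hi => hg i (mem_insert_of_mem hi)))
    have hu : u ∈ Ideal.span {F b, c} := by
      refine IsNonzerodivisorMod.prod s (fun i hi => h b (mem_insert_self _ _) i
        (mem_insert_of_mem hi) (by rintro rfl; exact hb hi)) u ?_
      have := Ideal.sub_mem _ (hg b (mem_insert_self _ _))
        (Ideal.mul_mem_left _ v (Ideal.subset_span (by simp : c ∈ ({F b, c} : Set A))))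
      simpa [mul_comm] using this
    obtain ⟨p, q, rfl⟩ := Ideal.mem_span_pair.1 hu
    exact Ideal.mem_span_pair.2 ⟨p, q * (∏ i ∈ s, F i) + v, by rw [prod_insert hb]; ring⟩

/-- If any three of the `F i` form a regular sequence in every order, then every element of
`⋂ (F i, F j)` is a combination of the products `∏_{j ≠ i} F j`. -/
lemma exists_eq_sum_mul_prod_erase {F : ι → A}
    (h : ∀ i j l, i ≠ j → i ≠ l → j ≠ l → IsNonzerodivisorMod (Ideal.span {F i, F j}) (F l))
    {s : Finset ι} (hs : s.Nonempty) (g : A)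
    (hg : ∀ i ∈ s, ∀ j ∈ s, i ≠ j → g ∈ Ideal.span {F i, F j}) :
    ∃ G : ι → A, g = ∑ i ∈ s, G i * ∏ j ∈ s.erase i, F j := by
  induction hs using Finset.Nonempty.cons_induction generalizing g with
  | singleton a => exact ⟨fun _ => g, by simp⟩
  | cons a s ha hs ih =>
    rw [cons_eq_insert] at hg ⊢
    have hne : ∀ i ∈ s, i ≠ a := by rintro i hi rfl; exact ha hi
    obtain ⟨u, v, huv⟩ := Ideal.mem_span_pair.1 (mem_span_prod_pair_s4 (c := F a) (g := g) s
      (fun i hi j hj hij => h i a j (hne i hi) hij (hne j hj).symm)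
      (fun i hi => hg i (mem_insert_of_mem hi) a (mem_insert_self _ _) (hne i hi)))
    have hv : ∀ i ∈ s, ∀ j ∈ s, i ≠ j → v ∈ Ideal.span {F i, F j} := by
      intro i hi j hj hij
      refine h i j a hij (hne i hi) (hne j hj) v ?_
      have hprod : ∏ l ∈ s, F l ∈ Ideal.span {F i, F j} :=
        Ideal.mem_of_dvd _ (dvd_prod_of_mem F hi) (Ideal.subset_span (by simp))
      have := Ideal.sub_mem _ (hg i (mem_insert_of_mem hi) j (mem_insert_of_mem hj) hij)
        (Ideal.mul_mem_left _ u hprod)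
      rwa [← huv, add_sub_cancel_left, mul_comm] at this
    obtain ⟨G, hG⟩ := ih v hv
    refine ⟨Function.update G a u, ?_⟩
    rw [sum_insert ha, erase_insert ha, Function.update_self, ← huv, hG, sum_mul]
    congr 1
    refine sum_congr rfl fun i hi => ?_
    rw [Function.update_of_ne (hne i hi), erase_insert_of_ne (hne i hi).symm,
      prod_insert (fun h' => ha (mem_of_mem_erase h'))]
    ring

end Generators

section Homogeneous

variable {k σ : Type*} [Field k]

lemma finrank_homogeneousSubmodule_fin_three (n : ℕ) :
    Module.finrank k (homogeneousSubmodule (Fin 3) k n) = (n + 2).choose 2 := by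
  have h := Module.finrank_eq_nat_card_basis
    (basisRestrictSupport k {e : Fin 3 →₀ ℕ | e.degree = n})
  have hset : {e : Fin 3 →₀ ℕ | e.degree = n} = ↑(finsuppAntidiag (univ : Finset (Fin 3)) n) := by
    ext e
    simp [Finsupp.degree_eq_sum]
  rw [hset] at h
  have hsub : homogeneousSubmodule (Fin 3) k n =
      restrictSupport k ↑(finsuppAntidiag (univ : Finset (Fin 3)) n) := by
    rw [← hset]
    exact homogeneousSubmodule_eq_finsupp_supported _ _ n
  rw [hsub, h, Nat.card_coe_set_eq, Set.ncard_coe_finset, card_finsuppAntidiag_nat_eq_choose,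
    Finset.card_univ, Fintype.card_fin, show 3 + n - 1 = n + 2 by omega]
  exact (Nat.choose_symm_add (a := n) (b := 2))

/-- The forms of degree `j - m`, where only `0` has negative degree. -/
noncomputable def shiftedForms (k σ : Type*) [Field k] (j m : ℕ) :
    Submodule k (MvPolynomial σ k) :=
  if m ≤ j then homogeneousSubmodule σ k (j - m) else ⊥

instance [Finite σ] (j m : ℕ) : Module.Finite k (shiftedForms k σ j m) := by
  refine Module.Finite.iff_fg.2 ?_
  unfold shiftedForms
  split_ifs
  · exact homogeneousSubmodule_fg σ k _
  · exact Submodule.fg_bot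

lemma finrank_shiftedForms (j m : ℕ) :
    Module.finrank k (shiftedForms k (Fin 3) j m) =
      (max ((j : ℤ) - m) (-1) + 2).toNat.choose 2 := by
  by_cases h : m ≤ j
  · rw [shiftedForms, if_pos h, finrank_homogeneousSubmodule_fin_three]
    congr
    omega
  · rw [shiftedForms, if_neg h, finrank_bot, show (max ((j : ℤ) - m) (-1) + 2).toNat = 1 by omega]
    rfl

lemma shiftedForms_mul_isHomogeneous {j m : ℕ} {G P : MvPolynomial σ k}
    (hG : G ∈ shiftedForms k σ j m) (hP : P.IsHomogeneous m) : (G * P).IsHomogeneous j := by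
  unfold shiftedForms at hG
  split_ifs at hG with h
  · simpa [h] using ((mem_homogeneousSubmodule _ _).1 hG).mul hP
  · rw [(Submodule.mem_bot k).1 hG, zero_mul]
    exact isHomogeneous_zero _ _ _

lemma exists_shiftedForms_homogeneousComponent_mul (j : ℕ) {m : ℕ} (G : MvPolynomial σ k)
    {P : MvPolynomial σ k} (hP : P.IsHomogeneous m) :
    ∃ G' ∈ shiftedForms k σ j m, homogeneousComponent j (G * P) = G' * P := by
  let _ := gradedAlgebra (σ := σ) (R := k)
  have hdec (φ : MvPolynomial σ k) (n : ℕ) :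
      (DirectSum.decompose (homogeneousSubmodule σ k) φ n : MvPolynomial σ k) =
        homogeneousComponent n φ := decomposition.decompose'_apply φ n
  unfold shiftedForms
  split_ifs with h
  · exact ⟨homogeneousComponent (j - m) G, homogeneousComponent_mem _ _, by
      rw [← hdec, ← hdec]
      exact DirectSum.coe_decompose_mul_of_right_mem_of_le (homogeneousSubmodule σ k) hP h⟩
  · exact ⟨0, Submodule.zero_mem _, by
      rw [zero_mul, ← hdec]
      exact DirectSum.coe_decompose_mul_of_right_mem_of_not_le (homogeneousSubmodule σ k) hP h⟩

lemma shiftedForms_eq_zero_of_dvd {j m e : ℕ} {G F : MvPolynomial σ k}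
    (hG : G ∈ shiftedForms k σ j m) (hF0 : F ≠ 0) (hF : F.IsHomogeneous e) (hj : j < m + e)
    (hdvd : F ∣ G) : G = 0 := by
  unfold shiftedForms at hG
  split_ifs at hG with h
  · by_contra hG0
    obtain ⟨q, rfl⟩ := hdvd
    have h1 := IsHomogeneous.totalDegree ((mem_homogeneousSubmodule _ _).1 hG) hG0
    rw [totalDegree_mul_of_isDomain hF0 (right_ne_zero_of_mul hG0), hF.totalDegree hF0] at h1
    omega
  · exact (Submodule.mem_bot k).1 hG

end Homogeneous

section Forms

variable {k : Type*} [Field k] {r : ℕ}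

/-- The map `(G i) ↦ ∑ G i * ∏_{j ≠ i} F j` on tuples of forms making the sum a form of
degree `j`. -/
noncomputable def cofactorMap (F : Fin r → MvPolynomial (Fin 3) k) (d : Fin r → ℕ) (j : ℕ) :
    (∀ i, shiftedForms k (Fin 3) j (∑ l ∈ univ.erase i, d l)) →ₗ[k] MvPolynomial (Fin 3) k :=
  ∑ i, (LinearMap.mulRight k (∏ l ∈ univ.erase i, F l)) ∘ₗ
    (Submodule.subtype _) ∘ₗ LinearMap.proj i

lemma cofactorMap_apply (F : Fin r → MvPolynomial (Fin 3) k) (d : Fin r → ℕ) (j : ℕ)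
    (G : ∀ i, shiftedForms k (Fin 3) j (∑ l ∈ univ.erase i, d l)) :
    cofactorMap F d j G = ∑ i, (G i : MvPolynomial (Fin 3) k) * ∏ l ∈ univ.erase i, F l := by
  simp [cofactorMap]

variable {F : Fin r → MvPolynomial (Fin 3) k} {d : Fin r → ℕ} {j : ℕ}

lemma cofactorMap_injective (hF : ∀ i, F i ≠ 0 ∧ (F i).IsHomogeneous (d i))
    (h : ∀ i l, i ≠ l → IsNonzerodivisorMod (Ideal.span {F i}) (F l)) (hj : j < ∑ i, d i) :
    Function.Injective (cofactorMap F d j) := by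
  rw [injective_iff_map_eq_zero]
  intro G hG
  rw [cofactorMap_apply] at hG
  ext1 i
  refine Subtype.ext (shiftedForms_eq_zero_of_dvd (G i).2 (hF i).1 (hF i).2 ?_ ?_)
  · rwa [sum_erase_add _ _ (mem_univ i)]
  · rw [← add_sum_erase _ _ (mem_univ i)] at hG
    rw [← Ideal.mem_span_singleton]
    refine IsNonzerodivisorMod.prod (univ.erase i)
      (fun l hl => h i l (ne_of_mem_erase hl).symm) _ ?_
    rw [mul_comm, eq_neg_of_add_eq_zero_left hG, neg_mem_iff]
    refine Ideal.sum_mem _ fun l hl => Ideal.mul_mem_left _ _ (Ideal.mem_span_singleton.2 ?_)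
    exact dvd_prod_of_mem F (mem_erase.2 ⟨(ne_of_mem_erase hl).symm, mem_univ i⟩)

lemma mem_idealOfForms {g : MvPolynomial (Fin 3) k} :
    g ∈ idealOfForms F ↔ ∀ i j, i ≠ j → g ∈ Ideal.span {F i, F j} := by
  simp only [idealOfForms, Ideal.mem_iInf]
  refine ⟨fun h i j hij => ?_, fun h i j hij => h i j hij.ne⟩
  rcases hij.lt_or_gt with h' | h'
  · exact h i j h'
  · rw [Set.pair_comm]
    exact h j i h'

lemma range_cofactorMap [NeZero r] (hF : ∀ i, (F i).IsHomogeneous (d i))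
    (h : ∀ i j l, i ≠ j → i ≠ l → j ≠ l → IsNonzerodivisorMod (Ideal.span {F i, F j}) (F l)) :
    LinearMap.range (cofactorMap F d j) =
      Submodule.restrictScalars k (idealOfForms F) ⊓ homogeneousSubmodule (Fin 3) k j := by
  have hP : ∀ i, (∏ l ∈ univ.erase i, F l).IsHomogeneous (∑ l ∈ univ.erase i, d l) :=
    fun i => IsHomogeneous.prod _ _ _ fun l _ => hF l
  ext g
  rw [Submodule.mem_inf, Submodule.restrictScalars_mem, mem_homogeneousSubmodule]
  constructor
  · rintro ⟨G, rfl⟩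
    rw [cofactorMap_apply]
    refine ⟨mem_idealOfForms.2 fun a b hab => Ideal.sum_mem _ fun i _ => ?_,
      IsHomogeneous.sum _ _ _ fun i _ => shiftedForms_mul_isHomogeneous (G i).2 (hP i)⟩
    refine Ideal.mul_mem_left _ _ ?_
    by_cases hia : a = i
    · exact Ideal.mem_of_dvd _
        (dvd_prod_of_mem F (mem_erase.2 ⟨fun hb => hab (hia.trans hb.symm), mem_univ b⟩))
        (Ideal.subset_span (by simp))
    · exact Ideal.mem_of_dvd _ (dvd_prod_of_mem F (mem_erase.2 ⟨hia, mem_univ a⟩))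
        (Ideal.subset_span (by simp))
  · rintro ⟨hgI, hg⟩
    obtain ⟨G, hG⟩ := exists_eq_sum_mul_prod_erase h (univ_nonempty (α := Fin r)) g
      fun i _ l _ hil => mem_idealOfForms.1 hgI i l hil
    choose G' hG' hGG' using fun i =>
      exists_shiftedForms_homogeneousComponent_mul j (G i) (hP i)
    refine ⟨fun i => ⟨G' i, hG' i⟩, ?_⟩
    rw [cofactorMap_apply, ← homogeneousComponent_eq_self hg, hG, map_sum]
    exact sum_congr rfl fun i _ => (hGG' i).symm

end Forms

section LinearForms

variable {k : Type*} [Field k]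

/-- The linear form `x₀ + t x₁ + t² x₂`; its coefficients are a point of a conic in the dual
plane, so no three of the lines it defines are concurrent. -/
noncomputable def conicLine (t : k) : MvPolynomial (Fin 3) k :=
  X 0 + C t * X 1 + C (t ^ 2) * X 2

lemma conicLine_isHomogeneous (t : k) : (conicLine t).IsHomogeneous 1 := by
  unfold conicLine
  exact ((isHomogeneous_X _ _).add (isHomogeneous_C_mul_X _ _)).add (isHomogeneous_C_mul_X _ _)

lemma conicLine_ne_zero (t : k) : conicLine t ≠ 0 := by
  intro h
  simpa [conicLine] using congrArg (eval ![1, 0, 0]) h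

lemma sub_aeval_mem {σ : Type*} {J : Ideal (MvPolynomial σ k)} {f : σ → MvPolynomial σ k}
    (hf : ∀ i, X i - f i ∈ J) (p : MvPolynomial σ k) : p - aeval f p ∈ J := by
  have h : (Ideal.Quotient.mkₐ k J).comp (aeval f) = Ideal.Quotient.mkₐ k J := by
    ext i
    simpa using (Ideal.Quotient.eq.2 (hf i)).symm
  exact Ideal.Quotient.eq.1 (DFunLike.congr_fun h p).symm

lemma mem_iff_aeval_eq_zero {σ : Type*} {s : Set (MvPolynomial σ k)} {f : σ → MvPolynomial σ k}
    (hf : ∀ i, X i - f i ∈ Ideal.span s) (hs : ∀ q ∈ s, aeval f q = 0) (p : MvPolynomial σ k) :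
    p ∈ Ideal.span s ↔ aeval f p = 0 := by
  constructor
  · intro hp
    exact (Ideal.span_le.2 hs : Ideal.span s ≤ RingHom.ker (aeval (R := k) f)) hp
  · intro hp
    have h := sub_aeval_mem hf p
    rwa [hp, sub_zero] at h

lemma conicLine_nonzerodivisor_singleton {a b : k} (hab : a ≠ b) :
    IsNonzerodivisorMod (Ideal.span {conicLine a}) (conicLine b) := by
  refine IsNonzerodivisorMod.of_algHom
    (aeval ![-(C a * X 1) - C (a ^ 2) * X 2, X 1, X 2]) (mem_iff_aeval_eq_zero ?_ ?_) ?_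
  · intro i
    fin_cases i
    · refine Ideal.mem_span_singleton'.2 ⟨1, ?_⟩
      simp [conicLine]
      ring
    · simp
    · simp
  · rintro q rfl
    simp [conicLine, algebraMap_eq]
    ring
  · intro h
    have := congrArg (eval ![0, 1, 0]) h
    simp [conicLine, algebraMap_eq] at this
    exact hab (by linear_combination -this)

lemma conicLine_nonzerodivisor_pair {a b c : k} (hab : a ≠ b) (hac : a ≠ c) (hbc : b ≠ c) :
    IsNonzerodivisorMod (Ideal.span {conicLine a, conicLine b}) (conicLine c) := by
  have hinv : (C (a - b)⁻¹ : MvPolynomial (Fin 3) k) * (C a - C b) = 1 := by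
    rw [← C_sub, ← C_mul, inv_mul_cancel₀ (sub_ne_zero.2 hab), C_1]
  refine IsNonzerodivisorMod.of_algHom
    (aeval ![C (a * b) * X 2, -(C (a + b) * X 2), X 2]) (mem_iff_aeval_eq_zero ?_ ?_) ?_
  · intro i
    fin_cases i
    · refine Ideal.mem_span_pair.2 ⟨-(C (a - b)⁻¹ * C b), C (a - b)⁻¹ * C a, ?_⟩
      simp only [conicLine, C_mul, C_pow]
      simp
      linear_combination (X 0 - C a * C b * X 2) * hinv
    · refine Ideal.mem_span_pair.2 ⟨C (a - b)⁻¹, -C (a - b)⁻¹, ?_⟩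
      simp only [conicLine, C_add, C_pow]
      simp
      linear_combination (X 1 + (C a + C b) * X 2) * hinv
    · simp
  · rintro q (rfl | rfl) <;> simp [conicLine, algebraMap_eq] <;> ring
  · intro h
    have := congrArg (eval ![0, 0, 1]) h
    simp [conicLine, algebraMap_eq] at this
    have h0 : (c - a) * (c - b) = 0 := by linear_combination this
    rcases mul_eq_zero.1 h0 with h0 | h0
    · exact hac (sub_eq_zero.1 h0).symm
    · exact hbc (sub_eq_zero.1 h0).symm

/-- Products of distinct forms `conicLine t` give forms of any degrees, any three of which
form a regular sequence in every order. -/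
lemma exists_regular_forms [Infinite k] {r : ℕ} (d : Fin r → ℕ) :
    ∃ F : Fin r → MvPolynomial (Fin 3) k,
      (∀ i, F i ≠ 0 ∧ (F i).IsHomogeneous (d i)) ∧
      (∀ i l, i ≠ l → IsNonzerodivisorMod (Ideal.span {F i}) (F l)) ∧
      ∀ i j l, i ≠ j → i ≠ l → j ≠ l →
        IsNonzerodivisorMod (Ideal.span {F i, F j}) (F l) := by
  obtain ⟨t⟩ : Nonempty ((Σ i, Fin (d i)) ↪ k) :=
    ⟨(Fintype.equivFin _).toEmbedding.trans (Fin.valEmbedding.trans (Infinite.natEmbedding k))⟩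
  have ht : ∀ {i l} (m : Fin (d i)) (n : Fin (d l)), i ≠ l → t ⟨i, m⟩ ≠ t ⟨l, n⟩ :=
    fun m n hil h => hil (congrArg Sigma.fst (t.injective h))
  refine ⟨fun i => ∏ m, conicLine (t ⟨i, m⟩), fun i => ⟨?_, ?_⟩, fun i l hil => ?_,
    fun i j l hij hil hjl => ?_⟩
  · exact prod_ne_zero_iff.2 fun m _ => conicLine_ne_zero _
  · simpa using IsHomogeneous.prod univ (fun m => conicLine (t ⟨i, m⟩)) (fun _ => 1)
      fun m _ => conicLine_isHomogeneous _
  · exact .prod _ fun n _ => .span_singleton_prod _ (fun m _ => conicLine_ne_zero _)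
      fun m _ => conicLine_nonzerodivisor_singleton (ht m n hil)
  · refine .prod _ fun n _ => .span_prod_pair _ (fun m _ => ?_) fun m _ => ?_
    · exact .span_singleton_prod _ (fun p _ => conicLine_ne_zero _)
        fun p _ => conicLine_nonzerodivisor_singleton (ht p m hij.symm)
    · rw [Set.pair_comm]
      refine .span_prod_pair _ (fun p _ => conicLine_nonzerodivisor_singleton (ht m p hij))
        fun p _ => ?_
      exact conicLine_nonzerodivisor_pair (ht p m hij.symm) (ht p n hjl) (ht m n hil)

end LinearForms

/-- Proposition 2.1(ii): for a general point `[F] = [F₁⋯F_r]` of `X_{2,λ}` and all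
`0 ≤ j ≤ d - 1`, `dim (I_F)_j = Σᵢ C(max {j - d + dᵢ, -1} + 2, 2)`, equivalently
`H(R/I_F, j) = C(j+2,2) - Σᵢ C(max {j - d + dᵢ, -1} + 2, 2)`. -/
theorem hilbert_function_low_degrees
    {k : Type*} [Field k] [IsAlgClosed k]
    (r : ℕ) [NeZero r] (hr : 2 ≤ r)
    (d : Fin r → ℕ)
    (hanti : ∀ i j : Fin r, i ≤ j → d j ≤ d i)
    (hpos : ∀ i, 1 ≤ d i) :
    ∃ F : Fin r → MvPolynomial (Fin 3) k,
      (∀ i, F i ≠ 0 ∧ (F i).IsHomogeneous (d i)) ∧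
      ∀ j : ℕ, j + 1 ≤ (∑ i, d i) →
        (gradedDim (idealOfForms F) j : ℤ) =
          ∑ i : Fin r,
            ((max ((j : ℤ) - (∑ i, d i) + d i) (-1) + 2).toNat.choose 2 : ℤ) := by
  have : Infinite k := IsAlgClosed.instInfinite
  obtain ⟨F, hF, h2, h3⟩ := exists_regular_forms (k := k) d
  refine ⟨F, hF, fun j hj => ?_⟩
  rw [gradedDim, ← range_cofactorMap (fun i => (hF i).2) h3,
    LinearMap.finrank_range_of_inj (cofactorMap_injective hF h2 hj), Module.finrank_pi_fintype,
    Nat.cast_sum]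
  refine sum_congr rfl fun i _ => ?_
  rw [finrank_shiftedForms, ← sum_erase_add univ d (mem_univ i)]
  congr 3
  push_cast
  ring_nf
end
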